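/- Let F be a successor key polynomial of Ψ_α (a monic polynomial of least degree in S_α). Then for every Q ∈ Ψ_α: δ_Q(F) = deg_Q(F), the leading coefficient of the Q-expansion of F equals 1, and ν_Q(F) = deg_Q(F)·ν(Q). -/

import Mathlib

open Polynomial

variable {K : Type*} [Field K]

/-- `ν` is a (rank one, real-valued) valuation on `K[x]`, specified on nonzero
polynomials. -/
def IsVal {K : Type*} [Field K] (ν : Polynomial K → ℝ) : Prop :=
  (∀ f g : Polynomial K, f ≠ 0 → g ≠ 0 → ν (f * g) = ν f + ν g) ∧
  (∀ f g : Polynomial K, f ≠ 0 → g ≠ 0 → f + g ≠ 0 → min (ν f) (ν g) ≤ ν (f + g))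

/-- The level `ε(f)` of a nonzero polynomial: the maximum of
`(ν f - ν (∂_b f))/b` over `b ≥ 1` (with `∂_b` the Hasse derivatives). -/
noncomputable def eps {K : Type*} [Field K] (ν : Polynomial K → ℝ) (f : Polynomial K) : ℝ :=
  sSup {r : ℝ | ∃ b : ℕ, 1 ≤ b ∧ hasseDeriv b f ≠ 0 ∧ r = (ν f - ν (hasseDeriv b f)) / b}

/-- The set `I(f)` of indices where the bound `ν(∂_b f) ≥ ν f - b ε(f)` is an equality. -/
def Iset {K : Type*} [Field K] (ν : Polynomial K → ℝ) (f : Polynomial K) : Set ℕ :=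
  {b | 1 ≤ b ∧ hasseDeriv b f ≠ 0 ∧ ν (hasseDeriv b f) = ν f - b * eps ν f}

/-- `Q` is a key polynomial for `ν`. -/
def IsKeyPol {K : Type*} [Field K] (ν : Polynomial K → ℝ) (Q : Polynomial K) : Prop :=
  Q.Monic ∧ 0 < Q.natDegree ∧
    ∀ f : Polynomial K, f ≠ 0 → f.natDegree < Q.natDegree → eps ν f < eps ν Q

/-- The coefficients of the `Q`-expansion of `f`:  `f = Σ i, qc Q f i * Q ^ i`
with `deg (qc Q f i) < deg Q`. -/
noncomputable def qc {K : Type*} [Field K] (Q : Polynomial K) : Polynomial K → ℕ → Polynomial K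
  | f, 0 => f %ₘ Q
  | f, (i + 1) => qc Q (f /ₘ Q) i

/-- The degree of the `Q`-expansion of `f`. -/
def degQ {K : Type*} [Field K] (Q f : Polynomial K) : ℕ := f.natDegree / Q.natDegree

/-- The truncation `ν_Q(f) = min_i ν (f_i Q^i)` of `ν` at `Q`. -/
noncomputable def nuQ {K : Type*} [Field K] (ν : Polynomial K → ℝ) (Q f : Polynomial K) : ℝ :=
  sInf {r : ℝ | ∃ i : ℕ, qc Q f i ≠ 0 ∧ r = ν (qc Q f i * Q ^ i)}

/-- The set `S_Q(f)` of indices attaining the minimum in `ν_Q(f)`. -/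
def SQ {K : Type*} [Field K] (ν : Polynomial K → ℝ) (Q f : Polynomial K) : Set ℕ :=
  {i | qc Q f i ≠ 0 ∧ ν (qc Q f i * Q ^ i) = nuQ ν Q f}

/-- `δ_Q(f) = max S_Q(f)`. -/
noncomputable def deltaQ {K : Type*} [Field K] (ν : Polynomial K → ℝ) (Q f : Polynomial K) : ℕ :=
  sSup (SQ ν Q f)

/-- The set `Ψ_α` of key polynomials for `ν` of degree `α`. -/
def Psi {K : Type*} [Field K] (ν : Polynomial K → ℝ) (α : ℕ) : Set (Polynomial K) :=
  {Q | IsKeyPol ν Q ∧ Q.natDegree = α}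

/-- The set `S_α` of (nonzero) polynomials whose value is not computed by any
truncation at a key polynomial of degree `α`. -/
def Slim {K : Type*} [Field K] (ν : Polynomial K → ℝ) (α : ℕ) : Set (Polynomial K) :=
  {f | f ≠ 0 ∧ ∀ Q ∈ Psi ν α, nuQ ν Q f < ν f}

/-- `p` is the characteristic exponent of the residue field of `ν`: either `p = 1`
and all nonzero natural numbers have value `0`, or `p` is a prime, `p` has
positive value (or is `0` in `K`), and naturals prime to `p` have value `0`. -/
def CharExp {K : Type*} [Field K] (ν : Polynomial K → ℝ) (p : ℕ) : Prop :=
  (p = 1 ∧ ∀ n : ℕ, (n : Polynomial K) ≠ 0 → ν (n : Polynomial K) = 0) ∨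
  (p.Prime ∧ ((p : Polynomial K) = 0 ∨ 0 < ν (p : Polynomial K)) ∧
    ∀ n : ℕ, ¬ p ∣ n → ν (n : Polynomial K) = 0)

namespace SuccExp

/-- `ν f ≥ c`, with the convention `ν 0 = ∞`. -/
def Vge {K : Type*} [Field K] (ν : Polynomial K → ℝ) (c : ℝ) (f : Polynomial K) : Prop :=
  f ≠ 0 → c ≤ ν f

/-- `ν f > c`, with the convention `ν 0 = ∞`. -/
def Vgt {K : Type*} [Field K] (ν : Polynomial K → ℝ) (c : ℝ) (f : Polynomial K) : Prop :=
  f ≠ 0 → c < ν f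

/-- `ν_Q f ≥ c`. -/
def NG {K : Type*} [Field K] (ν : Polynomial K → ℝ) (Q : Polynomial K) (c : ℝ)
    (f : Polynomial K) : Prop :=
  ∀ i : ℕ, Vge ν (c - i * ν Q) (qc Q f i)

section val

variable {ν : Polynomial K → ℝ} (hν : IsVal ν)
include hν

lemma v_one : ν 1 = 0 := by
  have h := hν.1 1 1 one_ne_zero one_ne_zero
  rw [one_mul] at h
  linarith

lemma v_neg (f : Polynomial K) : ν (-f) = ν f := by
  by_cases hf : f = 0
  · simp [hf]
  have h1 : ν (-1) = 0 := by
    have h := hν.1 (-1) (-1) (neg_ne_zero.2 one_ne_zero) (neg_ne_zero.2 one_ne_zero)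
    rw [neg_mul_neg, one_mul, v_one hν] at h
    linarith
  have h := hν.1 (-1) f (neg_ne_zero.2 one_ne_zero) hf
  rw [h1] at h
  simpa using h

lemma v_pow {f : Polynomial K} (hf : f ≠ 0) (n : ℕ) : ν (f ^ n) = n * ν f := by
  induction n with
  | zero => simp [v_one hν]
  | succ n ih =>
    rw [pow_succ, hν.1 _ _ (pow_ne_zero _ hf) hf, ih]
    push_cast; ring

lemma vge_add {c : ℝ} {f g : Polynomial K} (hf : Vge ν c f) (hg : Vge ν c g) :
    Vge ν c (f + g) := by
  intro h
  by_cases h1 : f = 0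
  · subst h1; rw [zero_add] at h ⊢; exact hg h
  by_cases h2 : g = 0
  · subst h2; rw [add_zero] at h ⊢; exact hf h
  exact (le_min (hf h1) (hg h2)).trans (hν.2 f g h1 h2 h)

lemma vgt_add {c : ℝ} {f g : Polynomial K} (hf : Vgt ν c f) (hg : Vgt ν c g) :
    Vgt ν c (f + g) := by
  intro h
  by_cases h1 : f = 0
  · subst h1; rw [zero_add] at h ⊢; exact hg h
  by_cases h2 : g = 0
  · subst h2; rw [add_zero] at h ⊢; exact hf h
  exact (lt_min (hf h1) (hg h2)).trans_le (hν.2 f g h1 h2 h)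

lemma vge_neg {c : ℝ} {f : Polynomial K} (hf : Vge ν c f) : Vge ν c (-f) := by
  intro h
  rw [v_neg hν]
  exact hf (neg_ne_zero.1 h)

lemma vgt_neg {c : ℝ} {f : Polynomial K} (hf : Vgt ν c f) : Vgt ν c (-f) := by
  intro h
  rw [v_neg hν]
  exact hf (neg_ne_zero.1 h)

lemma vgt_sum {ι : Type*} {c : ℝ} (s : Finset ι) (f : ι → Polynomial K)
    (h : ∀ i ∈ s, Vgt ν c (f i)) : Vgt ν c (∑ i ∈ s, f i) := by
  classical
  induction s using Finset.induction_on with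
  | empty => intro h; simp at h
  | insert a s ha ih =>
    rw [Finset.sum_insert ha]
    exact vgt_add hν (h a (Finset.mem_insert_self _ _))
      (ih fun i hi => h i (Finset.mem_insert_of_mem hi))

lemma vge_mul {c d : ℝ} {f g : Polynomial K} (hf : Vge ν c f) (hg : Vge ν d g) :
    Vge ν (c + d) (f * g) := by
  intro h
  have h1 := left_ne_zero_of_mul h
  have h2 := right_ne_zero_of_mul h
  rw [hν.1 f g h1 h2]
  exact add_le_add (hf h1) (hg h2)

end val

lemma vge_mono {ν : Polynomial K → ℝ} {c d : ℝ} {f : Polynomial K} (h : d ≤ c)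
    (hf : Vge ν c f) : Vge ν d f := fun hn => h.trans (hf hn)

lemma vge_zero {ν : Polynomial K → ℝ} {c : ℝ} : Vge ν c 0 := fun h => absurd rfl h

/-! ### Levels -/

lemma eps_set_finite (ν : Polynomial K → ℝ) (f : Polynomial K) :
    {r : ℝ | ∃ b : ℕ, 1 ≤ b ∧ hasseDeriv b f ≠ 0 ∧
      r = (ν f - ν (hasseDeriv b f)) / b}.Finite := by
  refine ((Set.finite_Iic f.natDegree).image
    (fun b : ℕ => (ν f - ν (hasseDeriv b f)) / b)).subset ?_
  rintro r ⟨b, _, hb, rfl⟩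
  refine ⟨b, ?_, rfl⟩
  by_contra hlt
  exact hb (hasseDeriv_eq_zero_of_lt_natDegree f b (by simpa using hlt))

lemma eps_ge (ν : Polynomial K → ℝ) (f : Polynomial K) {b : ℕ} (hb : 1 ≤ b)
    (h : hasseDeriv b f ≠ 0) : ν f - b * eps ν f ≤ ν (hasseDeriv b f) := by
  have h1 : (ν f - ν (hasseDeriv b f)) / b ≤ eps ν f :=
    le_csSup (eps_set_finite ν f).bddAbove ⟨b, hb, h, rfl⟩
  have hb' : (0 : ℝ) < b := by exact_mod_cast hb
  rw [div_le_iff₀ hb'] at h1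
  linarith

lemma eps_attained (ν : Polynomial K → ℝ) {Q : Polynomial K} (hm : Q.Monic)
    (hd : 0 < Q.natDegree) :
    ∃ b : ℕ, 1 ≤ b ∧ hasseDeriv b Q ≠ 0 ∧ ν (hasseDeriv b Q) = ν Q - b * eps ν Q := by
  have hne : {r : ℝ | ∃ b : ℕ, 1 ≤ b ∧ hasseDeriv b Q ≠ 0 ∧
      r = (ν Q - ν (hasseDeriv b Q)) / b}.Nonempty := by
    refine ⟨_, Q.natDegree, hd, ?_, rfl⟩
    intro h
    have h2 := congrArg (fun p => coeff p 0) h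
    simp [hasseDeriv_coeff, hm.coeff_natDegree] at h2
  obtain ⟨b, hb, h, he⟩ := hne.csSup_mem (eps_set_finite ν Q)
  refine ⟨b, hb, h, ?_⟩
  have hb' : (0 : ℝ) < b := by exact_mod_cast hb
  have : eps ν Q = (ν Q - ν (hasseDeriv b Q)) / b := he
  rw [this]
  field_simp
  ring

section key

variable {ν : Polynomial K → ℝ} (hν : IsVal ν) {Q : Polynomial K} (hQ : IsKeyPol ν Q)
include hν hQ

omit hν in
lemma small_deriv {h : Polynomial K} (hh : h ≠ 0) (hd : h.natDegree < Q.natDegree) {b : ℕ}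
    (hb : 1 ≤ b) : Vgt ν (ν h - b * eps ν Q) (hasseDeriv b h) := by
  intro hn
  have h1 := eps_ge ν h hb hn
  have h2 := hQ.2.2 h hh hd
  have hb' : (0 : ℝ) < b := by exact_mod_cast hb
  have := mul_lt_mul_of_pos_left h2 hb'
  linarith

omit hQ in
lemma small_deriv_mul {e : ℝ} {f g : Polynomial K} (hf : f ≠ 0) (hg : g ≠ 0)
    (h1 : ∀ b : ℕ, 1 ≤ b → Vgt ν (ν f - b * e) (hasseDeriv b f))
    (h2 : ∀ b : ℕ, 1 ≤ b → Vgt ν (ν g - b * e) (hasseDeriv b g)) {b : ℕ}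
    (hb : 1 ≤ b) : Vgt ν (ν (f * g) - b * e) (hasseDeriv b (f * g)) := by
  rw [hasseDeriv_mul]
  apply vgt_sum hν
  rintro ⟨i, j⟩ hij hn
  rw [Finset.HasAntidiagonal.mem_antidiagonal] at hij
  simp only at hij hn ⊢
  have n1 := left_ne_zero_of_mul hn
  have n2 := right_ne_zero_of_mul hn
  rw [hν.1 _ _ n1 n2, hν.1 _ _ hf hg]
  subst hij
  push_cast
  rcases Nat.eq_zero_or_pos i with hi | hi <;> rcases Nat.eq_zero_or_pos j with hj | hj
  · omega
  · subst hi
    have := h2 j hj n2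
    simp only [hasseDeriv_zero, LinearMap.id_coe, id_eq, Nat.cast_zero] at *
    linarith
  · subst hj
    have := h1 i hi n1
    simp only [hasseDeriv_zero, LinearMap.id_coe, id_eq, Nat.cast_zero] at *
    linarith
  · have := h1 i hi n1
    have := h2 j hj n2
    linarith

/-- The core lemma. -/
lemma core {f g q r : Polynomial K} (hf : f ≠ 0) (hg : g ≠ 0) (hq : q ≠ 0)
    (df : f.natDegree < Q.natDegree) (dg : g.natDegree < Q.natDegree)
    (dr : r.natDegree < Q.natDegree) (h : f * g = r + Q * q) :
    ν (f * g) < ν Q + ν q := by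
  by_contra hcon
  push Not at hcon
  have hQ0 : Q ≠ 0 := hQ.1.ne_zero
  have dq : q.natDegree < Q.natDegree := by
    have e1 : (Q * q).natDegree = Q.natDegree + q.natDegree := natDegree_mul hQ0 hq
    have e2 : Q * q = f * g - r := by rw [h]; ring
    have e3 : (f * g - r).natDegree ≤ max (f * g).natDegree r.natDegree := natDegree_sub_le _ _
    have e4 : (f * g).natDegree = f.natDegree + g.natDegree := natDegree_mul hf hg
    rw [e2] at e1
    rcases le_max_iff.1 e3 with h | h <;> omega
  obtain ⟨b, hb, hbn, hbe⟩ := eps_attained ν hQ.1 hQ.2.1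
  set e := eps ν Q with he
  have hfg : Vgt ν (ν Q + ν q - b * e) (hasseDeriv b (f * g)) := by
    intro hn
    have := small_deriv_mul hν hf hg (fun b hb => small_deriv hQ hf df hb)
      (fun b hb => small_deriv hQ hg dg hb) hb hn
    linarith
  have hr : Vgt ν (ν Q + ν q - b * e) (hasseDeriv b r) := by
    by_cases hr0 : r = 0
    · intro hn; simp [hr0] at hn
    intro hn
    have h1 := small_deriv hQ hr0 dr hb hn
    have h2 : Vge ν (ν Q + ν q) r := by
      have : r = f * g + -(Q * q) := by rw [h]; ring
      rw [this]
      refine vge_add hν (fun _ => hcon) (vge_neg hν fun _ => ?_)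
      rw [hν.1 _ _ hQ0 hq]
    have := h2 hr0
    linarith
  have hs : Vgt ν (ν Q + ν q - b * e) (hasseDeriv b (Q * q)) := by
    have : hasseDeriv b (Q * q) = hasseDeriv b (f * g) + -hasseDeriv b r := by
      rw [h, map_add]; ring
    rw [this]
    exact vgt_add hν hfg (vgt_neg hν hr)
  have hmain : Vgt ν (ν Q + ν q - b * e) (hasseDeriv b Q * q) := by
    have hsum := hasseDeriv_mul (f := Q) (g := q) b
    have hmem : (b, 0) ∈ Finset.HasAntidiagonal.antidiagonal b := by simp
    rw [← Finset.add_sum_erase _ _ hmem] at hsum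
    simp only [hasseDeriv_zero, LinearMap.id_coe, id_eq] at hsum
    have : hasseDeriv b Q * q = hasseDeriv b (Q * q) +
      -(∑ x ∈ (Finset.HasAntidiagonal.antidiagonal b).erase (b, 0),
        hasseDeriv x.1 Q * hasseDeriv x.2 q) := by rw [hsum]; ring
    rw [this]
    refine vgt_add hν hs (vgt_neg hν (vgt_sum hν _ _ ?_))
    rintro ⟨i, j⟩ hij hn
    rw [Finset.mem_erase, Finset.HasAntidiagonal.mem_antidiagonal] at hij
    obtain ⟨hij1, hij2⟩ := hij
    simp only at hij2 hn ⊢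
    have n1 := left_ne_zero_of_mul hn
    have n2 := right_ne_zero_of_mul hn
    rw [hν.1 _ _ n1 n2]
    have hj : 1 ≤ j := by
      rcases Nat.eq_zero_or_pos j with hj | hj
      · subst hj
        exact absurd (by simpa using hij2) (by simpa using hij1)
      · exact hj
    have hj1 := small_deriv hQ hq dq hj n2
    subst hij2
    push_cast
    rcases Nat.eq_zero_or_pos i with hi | hi
    · subst hi
      simp only [hasseDeriv_zero, LinearMap.id_coe, id_eq, Nat.cast_zero] at *
      linarith
    · have := eps_ge ν Q hi n1
      rw [← he] at *
      linarith
  have := hmain (mul_ne_zero hbn hq)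
  rw [hν.1 _ _ hbn hq, hbe] at this
  linarith

end key

/-! ### `Q`-expansions -/

section expansion

variable {Q : Polynomial K} (hm : Q.Monic) (hpos : 0 < Q.natDegree)
include hm hpos

lemma lt_deg_iff {r : Polynomial K} : r.degree < Q.degree ↔ r.natDegree < Q.natDegree := by
  by_cases hr : r = 0
  · simp [hr, hpos, bot_lt_iff_ne_bot, hm.ne_zero]
  · rw [degree_eq_natDegree hm.ne_zero, degree_eq_natDegree hr]
    exact Nat.cast_lt

lemma exp_unique {r t : Polynomial K} (hr : r.natDegree < Q.natDegree) :
    (r + Q * t) /ₘ Q = t ∧ (r + Q * t) %ₘ Q = r :=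
  div_modByMonic_unique t r hm ⟨rfl, (lt_deg_iff hm hpos).2 hr⟩

lemma mod_deg (f : Polynomial K) : (f %ₘ Q).natDegree < Q.natDegree :=
  (lt_deg_iff hm hpos).1 (degree_modByMonic_lt f hm)

lemma exp_induction {P : Polynomial K → Prop} (h0 : P 0)
    (hs : ∀ r t : Polynomial K, r.natDegree < Q.natDegree → P t → P (r + Q * t)) :
    ∀ f, P f := by
  suffices H : ∀ n : ℕ, ∀ f : Polynomial K, f.natDegree ≤ n → P f from
    fun f => H _ f le_rfl
  intro n
  induction n with
  | zero =>
    intro f hf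
    have := hs f 0 (by omega) h0
    simpa using this
  | succ n ih =>
    intro f hf
    by_cases hlt : f.natDegree < Q.natDegree
    · have := hs f 0 hlt h0
      simpa using this
    · rw [← modByMonic_add_div f Q]
      refine hs _ _ (mod_deg hm hpos f) (ih _ ?_)
      rw [natDegree_divByMonic f hm]
      omega

lemma qc_zero (i : ℕ) : qc Q 0 i = 0 := by
  induction i with
  | zero => simp [qc]
  | succ i ih => simp [qc, ih]

lemma qc_natDegree (f : Polynomial K) (i : ℕ) : (qc Q f i).natDegree < Q.natDegree := by
  induction i generalizing f with
  | zero => exact mod_deg hm hpos f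
  | succ i ih => exact ih _

lemma qc_eq_zero {f : Polynomial K} {i : ℕ} (h : f.natDegree < i * Q.natDegree) :
    qc Q f i = 0 := by
  induction i generalizing f with
  | zero => simp at h
  | succ i ih =>
    by_cases hlt : f.natDegree < Q.natDegree
    · have := (divByMonic_eq_zero_iff hm).2 ((lt_deg_iff hm hpos).2 hlt)
      simp [qc, this, qc_zero hm hpos]
    · refine ih ?_
      rw [natDegree_divByMonic f hm]
      rw [add_mul, one_mul] at h
      omega

lemma eq_zero_of_qc {f : Polynomial K} (h : ∀ i, qc Q f i = 0) : f = 0 := by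
  revert h
  refine exp_induction hm hpos (P := fun f => (∀ i, qc Q f i = 0) → f = 0) (fun _ => rfl) ?_ f
  intro r t hr ih h
  obtain ⟨e1, e2⟩ := exp_unique hm hpos (t := t) hr
  have h0 : r = 0 := by have := h 0; simpa only [qc, e2] using this
  have ht : t = 0 := ih fun i => by have := h (i + 1); simpa only [qc, e1] using this
  simp [h0, ht]

lemma qc_monic {n : ℕ} {f : Polynomial K} (hf : f.Monic) (h1 : n * Q.natDegree ≤ f.natDegree)
    (h2 : f.natDegree < (n + 1) * Q.natDegree) :
    (qc Q f n).Monic ∧ (qc Q f n).natDegree + n * Q.natDegree = f.natDegree := by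
  induction n generalizing f with
  | zero =>
    have : f %ₘ Q = f := (modByMonic_eq_self_iff hm).2 ((lt_deg_iff hm hpos).2 (by simpa using h2))
    simp [qc, this, hf]
  | succ n ih =>
    rw [add_mul, one_mul] at h1 h2
    have hd := natDegree_divByMonic f hm
    have hmon : (f /ₘ Q).Monic := by
      rw [Monic, leadingCoeff_divByMonic_of_monic hm]
      · exact hf
      · rw [degree_eq_natDegree hm.ne_zero, degree_eq_natDegree hf.ne_zero]
        exact_mod_cast (by omega)
    obtain ⟨a, b⟩ := ih hmon (by omega) (by rw [hd]; omega)
    refine ⟨a, ?_⟩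
    change (qc Q (f /ₘ Q) n).natDegree + _ = _
    rw [add_mul, one_mul]
    omega

end expansion

/-! ### Truncations -/

section trunc

variable {ν : Polynomial K → ℝ} {Q : Polynomial K} (hm : Q.Monic) (hpos : 0 < Q.natDegree)

lemma ng_iff {c : ℝ} {f : Polynomial K} :
    NG ν Q c f ↔ Vge ν c (f %ₘ Q) ∧ NG ν Q (c - ν Q) (f /ₘ Q) := by
  constructor
  · intro h
    refine ⟨by simpa [qc] using h 0, fun i => ?_⟩
    have := h (i + 1)
    push_cast at this
    rw [show c - ν Q - i * ν Q = c - (i + 1) * ν Q by ring]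
    exact this
  · rintro ⟨h0, h1⟩ i
    cases i with
    | zero => simpa [qc] using h0
    | succ i =>
      have := h1 i
      push_cast
      rw [show c - ν Q - i * ν Q = c - (i + 1) * ν Q by ring] at this
      exact this

lemma ng_mono {c d : ℝ} {f : Polynomial K} (h : d ≤ c) (hf : NG ν Q c f) : NG ν Q d f :=
  fun i => vge_mono (by linarith) (hf i)

include hm hpos

lemma ng_exp {c : ℝ} {r t : Polynomial K} (hr : r.natDegree < Q.natDegree) :
    NG ν Q c (r + Q * t) ↔ Vge ν c r ∧ NG ν Q (c - ν Q) t := by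
  obtain ⟨e1, e2⟩ := exp_unique hm hpos (t := t) hr
  rw [ng_iff, e1, e2]

lemma ng_zero {c : ℝ} : NG ν Q c 0 := fun i => by
  rw [qc_zero hm hpos]; exact vge_zero

lemma ng_small {c : ℝ} {r : Polynomial K} (hr : r.natDegree < Q.natDegree) :
    NG ν Q c r ↔ Vge ν c r := by
  have := ng_exp (ν := ν) (c := c) (t := 0) hm hpos hr
  rw [mul_zero, add_zero] at this
  rw [this]
  exact ⟨fun h => h.1, fun h => ⟨h, ng_zero hm hpos⟩⟩

lemma ng_Qmul {c : ℝ} {t : Polynomial K} : NG ν Q c (Q * t) ↔ NG ν Q (c - ν Q) t := by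
  have := ng_exp (ν := ν) (c := c) (r := 0) (t := t) hm hpos (by simpa using hpos)
  rw [zero_add] at this
  rw [this]
  exact ⟨fun h => h.2, fun h => ⟨vge_zero, h⟩⟩

variable (hν : IsVal ν)
include hν

lemma ng_add {c : ℝ} {f g : Polynomial K} (hf : NG ν Q c f) (hg : NG ν Q c g) :
    NG ν Q c (f + g) := by
  revert hf hg
  refine exp_induction hm hpos (P := fun f => ∀ c g, NG ν Q c f → NG ν Q c g → NG ν Q c (f + g))
    ?_ ?_ f c g
  · intro c g _ h; simpa using h
  · intro r t hr ih c g hf hg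
    rw [ng_exp hm hpos hr] at hf
    have hg' := ng_iff.1 hg
    have e : r + Q * t + g = (r + g %ₘ Q) + Q * (t + g /ₘ Q) := by
      conv_lhs => rw [← modByMonic_add_div g Q]
      ring
    rw [e, ng_exp hm hpos]
    · exact ⟨vge_add hν hf.1 hg'.1, ih _ _ hf.2 hg'.2⟩
    · exact (natDegree_add_le _ _).trans_lt (max_lt hr (mod_deg hm hpos g))

lemma ng_neg {c : ℝ} {f : Polynomial K} (hf : NG ν Q c f) : NG ν Q c (-f) := by
  revert hf
  refine exp_induction hm hpos (P := fun f => ∀ c, NG ν Q c f → NG ν Q c (-f))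
    ?_ ?_ f c
  · intro c h; simpa using h
  · intro r t hr ih c hf
    rw [ng_exp hm hpos hr] at hf
    rw [show -(r + Q * t) = -r + Q * (-t) by ring, ng_exp hm hpos (by simpa using hr)]
    exact ⟨vge_neg hν hf.1, ih _ hf.2⟩

lemma ng_sub {c : ℝ} {f g : Polynomial K} (hf : NG ν Q c f) (hg : NG ν Q c g) :
    NG ν Q c (f - g) := by
  rw [sub_eq_add_neg]
  exact ng_add hm hpos hν hf (ng_neg hm hpos hν hg)

lemma ng_vge {c : ℝ} {f : Polynomial K} (hf : NG ν Q c f) : Vge ν c f := by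
  revert hf
  refine exp_induction hm hpos (P := fun f => ∀ c, NG ν Q c f → Vge ν c f)
    ?_ ?_ f c
  · intro c _; exact vge_zero
  · intro r t hr ih c hf
    rw [ng_exp hm hpos hr] at hf
    refine vge_add hν hf.1 ?_
    have := vge_mul hν (f := Q) (g := t) (c := ν Q) (fun _ => le_rfl) (ih _ hf.2)
    simpa using this

end trunc

section keytrunc

variable {ν : Polynomial K → ℝ} (hν : IsVal ν) {Q : Polynomial K} (hQ : IsKeyPol ν Q)
include hν hQ

/-- Dividing a product of two small polynomials by `Q`. -/
lemma small_mul {f g : Polynomial K} (hf : f ≠ 0) (hg : g ≠ 0)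
    (df : f.natDegree < Q.natDegree) (dg : g.natDegree < Q.natDegree) :
    ∃ r t : Polynomial K, f * g = r + Q * t ∧ r.natDegree < Q.natDegree ∧
      t.natDegree < Q.natDegree ∧ r ≠ 0 ∧ ν r = ν f + ν g ∧ Vge ν (ν f + ν g - ν Q) t := by
  have hdr := mod_deg hQ.1 hQ.2.1 (f * g)
  have he := (modByMonic_add_div (f * g) Q).symm
  set r := f * g %ₘ Q
  set t := f * g /ₘ Q with ht
  have hfg : f * g ≠ 0 := mul_ne_zero hf hg
  have hdt : t.natDegree < Q.natDegree := by
    rw [ht, natDegree_divByMonic _ hQ.1, natDegree_mul hf hg]; omega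
  have hv := hν.1 f g hf hg
  by_cases ht0 : t = 0
  · rw [ht0, mul_zero, add_zero] at he
    refine ⟨r, t, by rw [ht0, mul_zero, add_zero]; exact he, hdr, hdt, he ▸ hfg, ?_, ?_⟩
    · rw [← he, hv]
    · rw [ht0]; exact vge_zero
  have hc := core hν hQ hf hg ht0 df dg hdr he
  have hQt : ν (Q * t) = ν Q + ν t := hν.1 _ _ hQ.1.ne_zero ht0
  have hr0 : r ≠ 0 := by
    intro h0
    rw [h0, zero_add] at he
    rw [he, hQt] at hc
    exact lt_irrefl _ hc
  refine ⟨r, t, he, hdr, hdt, hr0, le_antisymm ?_ ?_, fun _ => by linarith⟩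
  · by_contra hlt
    push Not at hlt
    have : Vgt ν (ν f + ν g) (f * g) := by
      rw [he]
      exact vgt_add hν (fun _ => hlt) (fun _ => by rw [hQt, ← hv]; exact hc)
    have := this hfg
    linarith
  · have : Vge ν (ν f + ν g) r := by
      have e : r = f * g + -(Q * t) := by rw [he]; ring
      rw [e]
      exact vge_add hν (fun _ => hv.ge) (vge_neg hν (fun _ => by rw [hQt, ← hv]; exact hc.le))
    exact this hr0

lemma ng_smul {c d : ℝ} {a g : Polynomial K} (da : a.natDegree < Q.natDegree)
    (ha : Vge ν c a) (hg : NG ν Q d g) : NG ν Q (c + d) (a * g) := by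
  by_cases ha0 : a = 0
  · rw [ha0, zero_mul]; exact ng_zero hQ.1 hQ.2.1
  revert hg
  refine exp_induction hQ.1 hQ.2.1 (P := fun g => ∀ d, NG ν Q d g → NG ν Q (c + d) (a * g))
    ?_ ?_ g d
  · intro d _; rw [mul_zero]; exact ng_zero hQ.1 hQ.2.1
  · intro r t hr ih d hg
    rw [ng_exp hQ.1 hQ.2.1 hr] at hg
    rw [show a * (r + Q * t) = a * r + Q * (a * t) by ring]
    refine ng_add hQ.1 hQ.2.1 hν ?_ ?_
    · by_cases hr0 : r = 0
      · rw [hr0, mul_zero]; exact ng_zero hQ.1 hQ.2.1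
      obtain ⟨r', t', he, h1, h2, h3, h4, h5⟩ := small_mul hν hQ ha0 hr0 da hr
      have A := ha ha0
      have B := hg.1 hr0
      rw [he, ng_exp hQ.1 hQ.2.1 h1, ng_small hQ.1 hQ.2.1 h2]
      exact ⟨fun _ => by linarith, vge_mono (by linarith) h5⟩
    · rw [ng_Qmul hQ.1 hQ.2.1]
      have := ih _ hg.2
      rwa [← add_sub_assoc] at this

lemma ng_mul {c d : ℝ} {f g : Polynomial K} (hf : NG ν Q c f) (hg : NG ν Q d g) :
    NG ν Q (c + d) (f * g) := by
  revert hf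
  refine exp_induction hQ.1 hQ.2.1 (P := fun f => ∀ c, NG ν Q c f → NG ν Q (c + d) (f * g))
    ?_ ?_ f c
  · intro d _; rw [zero_mul]; exact ng_zero hQ.1 hQ.2.1
  · intro r t hr ih c hf
    rw [ng_exp hQ.1 hQ.2.1 hr] at hf
    rw [show (r + Q * t) * g = r * g + Q * (t * g) by ring]
    refine ng_add hQ.1 hQ.2.1 hν (ng_smul hν hQ hr hf.1 hg) ?_
    rw [ng_Qmul hQ.1 hQ.2.1]
    have := ih _ hf.2
    rwa [show c + d - ν Q = c - ν Q + d by ring]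

lemma ng_pow {c : ℝ} {f : Polynomial K} (hf : NG ν Q c f) (n : ℕ) :
    NG ν Q (n * c) (f ^ n) := by
  induction n with
  | zero =>
    rw [pow_zero, ng_small hQ.1 hQ.2.1 (by simpa using hQ.2.1)]
    intro _
    simp [v_one hν]
  | succ n ih =>
    rw [pow_succ]
    have := ng_mul hν hQ ih hf
    push_cast
    rwa [add_mul, one_mul]

lemma ng_cancel {c : ℝ} {a g : Polynomial K} (da : a.natDegree < Q.natDegree)
    (ha : a ≠ 0) (hg : NG ν Q c (a * g)) : NG ν Q (c - ν a) g := by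
  revert hg
  refine exp_induction hQ.1 hQ.2.1 (P := fun g => ∀ c, NG ν Q c (a * g) → NG ν Q (c - ν a) g)
    ?_ ?_ g c
  · intro c _; exact ng_zero hQ.1 hQ.2.1
  · intro r t hr ih c hg
    rw [show a * (r + Q * t) = a * r + Q * (a * t) by ring] at hg
    rw [ng_exp hQ.1 hQ.2.1 hr, sub_right_comm]
    by_cases hr0 : r = 0
    · rw [hr0, mul_zero, zero_add, ng_Qmul hQ.1 hQ.2.1] at hg
      exact ⟨by rw [hr0]; exact vge_zero, ih _ hg⟩
    obtain ⟨r', t', he, h1, h2, h3, h4, h5⟩ := small_mul hν hQ ha hr0 da hr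
    rw [he, add_assoc, ← mul_add, ng_exp hQ.1 hQ.2.1 h1] at hg
    have A := hg.1 h3
    refine ⟨fun _ => by linarith, ih _ ?_⟩
    have e : a * t = (t' + a * t) - t' := by ring
    rw [e]
    refine ng_sub hQ.1 hQ.2.1 hν hg.2 ?_
    rw [ng_small hQ.1 hQ.2.1 h2]
    exact vge_mono (by linarith) h5

end keytrunc

/-! ### Changing the key polynomial -/

section change

variable {ν : Polynomial K → ℝ} (hν : IsVal ν) {α : ℕ} {Q Q' : Polynomial K}
  (hQ : Q ∈ Psi ν α) (hQ' : Q' ∈ Psi ν α)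

include hQ hQ' in
lemma sub_deg : (Q' - Q).natDegree < Q.natDegree := by
  rw [← lt_deg_iff hQ.1.1 hQ.1.2.1]
  have h : Q'.natDegree = Q.natDegree := hQ'.2.trans hQ.2.symm
  have hd : Q'.degree = Q.degree := by
    rw [degree_eq_natDegree hQ.1.1.ne_zero, degree_eq_natDegree hQ'.1.1.ne_zero, h]
  rw [← hd]
  exact degree_sub_lt_left hd hQ'.1.1.ne_zero (by rw [hQ.1.1.leadingCoeff, hQ'.1.1.leadingCoeff])

include hν hQ hQ'

lemma ng_other {c : ℝ} (h : c ≤ ν Q) (h' : c ≤ ν Q') : NG ν Q c Q' := by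
  have e : Q' = (Q' - Q) + Q * 1 := by ring
  rw [e, ng_exp hQ.1.1 hQ.1.2.1 (sub_deg hQ hQ'), ng_small hQ.1.1 hQ.1.2.1
    (by simpa using hQ.1.2.1)]
  refine ⟨?_, fun _ => by rw [v_one hν]; linarith⟩
  rw [sub_eq_add_neg]
  exact vge_add hν (fun _ => h') (vge_neg hν fun _ => h)

lemma ng_up {c : ℝ} {f : Polynomial K} (h : ν Q ≤ ν Q') (hf : NG ν Q c f) : NG ν Q' c f := by
  revert hf
  refine exp_induction hQ.1.1 hQ.1.2.1 (P := fun f => ∀ c, NG ν Q c f → NG ν Q' c f) ?_ ?_ f c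
  · intro c _; exact ng_zero hQ'.1.1 hQ'.1.2.1
  · intro r t hr ih c hf
    rw [ng_exp hQ.1.1 hQ.1.2.1 hr] at hf
    refine ng_add hQ'.1.1 hQ'.1.2.1 hν ?_ ?_
    · rw [ng_small hQ'.1.1 hQ'.1.2.1 (by rw [hQ'.2, ← hQ.2]; exact hr)]
      exact hf.1
    · have := ng_mul hν hQ'.1 (ng_other hν hQ' hQ h le_rfl) (ih _ hf.2)
      simpa using this

lemma ng_down {n : ℕ} {c : ℝ} {f : Polynomial K} (h : ν Q ≤ ν Q')
    (hd : f.natDegree < (n + 1) * α) (hf : NG ν Q' c f) :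
    NG ν Q (c - n * (ν Q' - ν Q)) f := by
  induction n generalizing f c with
  | zero =>
    have hd' : f.natDegree < α := by simpa using hd
    rw [ng_small hQ.1.1 hQ.1.2.1 (by rw [hQ.2]; exact hd')]
    rw [ng_small hQ'.1.1 hQ'.1.2.1 (by rw [hQ'.2]; exact hd')] at hf
    simpa using hf
  | succ n ih =>
    have h2 := ng_iff.1 hf
    rw [← modByMonic_add_div f Q']
    have hnn : (0 : ℝ) ≤ n := Nat.cast_nonneg n
    have hα : 0 < α := hQ.2 ▸ hQ.1.2.1
    refine ng_add hQ.1.1 hQ.1.2.1 hν ?_ ?_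
    · rw [ng_small hQ.1.1 hQ.1.2.1 (by
        rw [hQ.2, ← hQ'.2]; exact mod_deg hQ'.1.1 hQ'.1.2.1 f)]
      refine vge_mono ?_ h2.1
      have : 0 ≤ ((n + 1 : ℕ) : ℝ) * (ν Q' - ν Q) :=
        mul_nonneg (Nat.cast_nonneg _) (by linarith)
      linarith
    · have hdd : (f /ₘ Q').natDegree < (n + 1) * α := by
        rw [natDegree_divByMonic f hQ'.1.1, hQ'.2]
        rw [add_mul, one_mul] at hd
        have : 0 < (n + 1) * α := by positivity
        omega
      have := ng_mul hν hQ.1 (ng_other hν hQ hQ' le_rfl h) (ih hdd h2.2)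
      refine ng_mono ?_ this
      push_cast
      linarith

end change

/-! ### Relation with `nuQ` -/

section nu

variable {ν : Polynomial K → ℝ} (hν : IsVal ν) {Q : Polynomial K} (hm : Q.Monic)
  (hpos : 0 < Q.natDegree)
include hν hm hpos

lemma nuQ_mem {f : Polynomial K} (hf : f ≠ 0) :
    ∃ i : ℕ, qc Q f i ≠ 0 ∧ nuQ ν Q f = ν (qc Q f i * Q ^ i) := by
  have hfin : {r : ℝ | ∃ i : ℕ, qc Q f i ≠ 0 ∧ r = ν (qc Q f i * Q ^ i)}.Finite := by
    refine ((Set.finite_Iic f.natDegree).image (fun i : ℕ => ν (qc Q f i * Q ^ i))).subset ?_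
    rintro r ⟨i, hi, rfl⟩
    refine ⟨i, ?_, rfl⟩
    by_contra hlt
    have hlt' : f.natDegree < i := by simpa using hlt
    exact hi (qc_eq_zero hm hpos (hlt'.trans_le (Nat.le_mul_of_pos_right _ hpos)))
  have hne : {r : ℝ | ∃ i : ℕ, qc Q f i ≠ 0 ∧ r = ν (qc Q f i * Q ^ i)}.Nonempty := by
    by_contra hcon
    refine hf (eq_zero_of_qc hm hpos fun i => ?_)
    by_contra hi
    exact hcon ⟨_, i, hi, rfl⟩
  exact hne.csInf_mem hfin

omit hpos in
lemma v_term {f : Polynomial K} {i : ℕ} (hi : qc Q f i ≠ 0) :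
    ν (qc Q f i * Q ^ i) = ν (qc Q f i) + i * ν Q := by
  rw [hν.1 _ _ hi (pow_ne_zero _ hm.ne_zero), v_pow hν hm.ne_zero]

lemma le_nuQ {f : Polynomial K} (hf : f ≠ 0) {c : ℝ} (h : NG ν Q c f) : c ≤ nuQ ν Q f := by
  obtain ⟨i, hi, he⟩ := nuQ_mem hν hm hpos hf
  rw [he, v_term hν hm hi]
  have := h i hi
  linarith

lemma nuQ_le {f : Polynomial K} {i : ℕ} (hi : qc Q f i ≠ 0) :
    nuQ ν Q f ≤ ν (qc Q f i * Q ^ i) := by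
  refine csInf_le ?_ ⟨i, hi, rfl⟩
  refine (Set.Finite.subset ((Set.finite_Iic f.natDegree).image
    (fun i : ℕ => ν (qc Q f i * Q ^ i))) ?_).bddBelow
  rintro r ⟨i, hi, rfl⟩
  refine ⟨i, ?_, rfl⟩
  by_contra hlt
  have hlt' : f.natDegree < i := by simpa using hlt
  exact hi (qc_eq_zero hm hpos (hlt'.trans_le (Nat.le_mul_of_pos_right _ hpos)))

lemma ng_of_le {f : Polynomial K} {c : ℝ} (h : c ≤ nuQ ν Q f) : NG ν Q c f := by
  intro i hi
  have := nuQ_le hν hm hpos hi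
  rw [v_term hν hm hi] at this
  linarith

end nu

/-- Comparison lemma. -/
lemma compare {ν : Polynomial K → ℝ} (hν : IsVal ν) {Q : Polynomial K} (hQ : IsKeyPol ν Q)
    {A R P : Polynomial K} (hA : NG ν Q (ν A) A)
    (hR : ∀ c, Vge ν c R → NG ν Q c R) (hP : P = A - R)
    (hPn : ¬ NG ν Q (ν P) P) : NG ν Q (ν A) P := by
  by_cases h : Vge ν (ν A) R
  · rw [hP]; exact ng_sub hQ.1 hQ.2.1 hν hA (hR _ h)
  exfalso
  unfold Vge at h
  push Not at h
  obtain ⟨h0, hlt⟩ := h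
  have h1 : NG ν Q (ν R) P := by
    rw [hP]; exact ng_sub hQ.1 hQ.2.1 hν (ng_mono hlt.le hA) (hR _ fun _ => le_rfl)
  refine hPn (ng_mono ?_ h1)
  by_contra hlt2
  push Not at hlt2
  have : Vgt ν (ν R) R := by
    have e : R = A + -P := by rw [hP]; ring
    conv => arg 3; rw [e]
    exact vgt_add hν (fun _ => hlt) (vgt_neg hν fun _ => hlt2)
  exact lt_irrefl _ (this h0)

section main

variable {ν : Polynomial K → ℝ} (hν : IsVal ν) {α : ℕ} {F : Polynomial K}
  (hFm : F.Monic) (hF : F ∈ Slim ν α) (hmin : ∀ g ∈ Slim ν α, F.natDegree ≤ g.natDegree)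

include hν hF in
lemma F_not {Q : Polynomial K} (hQ : Q ∈ Psi ν α) : ¬ NG ν Q (ν F) F := fun h =>
  absurd (le_nuQ hν hQ.1.1 hQ.1.2.1 hF.1 h) (not_le.2 (hF.2 Q hQ))

include hν hmin in
lemma small_T {Q0 : Polynomial K} (hQ0 : Q0 ∈ Psi ν α) {h : Polynomial K}
    (hd : h.natDegree < F.natDegree) :
    ∃ Q ∈ Psi ν α, ν Q0 ≤ ν Q ∧ ∀ c, Vge ν c h → NG ν Q c h := by
  by_cases h0 : h = 0
  · exact ⟨Q0, hQ0, le_rfl, fun c _ => by rw [h0]; exact ng_zero hQ0.1.1 hQ0.1.2.1⟩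
  have hn : h ∉ Slim ν α := fun hS => absurd (hmin h hS) (not_le.2 hd)
  have : ∃ Q ∈ Psi ν α, ν h ≤ nuQ ν Q h := by
    by_contra hcon
    push Not at hcon
    exact hn ⟨h0, hcon⟩
  obtain ⟨Q, hQ, hle⟩ := this
  have hng := ng_of_le hν hQ.1.1 hQ.1.2.1 hle
  rcases le_total (ν Q0) (ν Q) with hc | hc
  · exact ⟨Q, hQ, hc, fun c hcv => ng_mono (hcv h0) hng⟩
  · exact ⟨Q0, hQ0, le_rfl, fun c hcv => ng_mono (hcv h0) (ng_up hν hQ hQ0 hc hng)⟩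

include hν hF in
lemma F_deg {Q : Polynomial K} (hQ : Q ∈ Psi ν α) : α ≤ F.natDegree := by
  by_contra hlt
  push Not at hlt
  refine F_not hν hF hQ ?_
  rw [ng_small hQ.1.1 hQ.1.2.1 (by rw [hQ.2]; exact hlt)]
  exact fun _ => le_rfl

/-- A product of two smaller polynomials that is monic of degree `α` has small value. -/
lemma prod_lt (hν : IsVal ν) {Q : Polynomial K} (hQ : Q ∈ Psi ν α) {f g : Polynomial K}
    (hf : f.Monic) (hg : g.Monic) (df : f.natDegree < α) (dg : g.natDegree < α)
    (hs : f.natDegree + g.natDegree = α) : ν f + ν g < ν Q := by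
  have hfg : (f * g).Monic := hf.mul hg
  have hd : (f * g).natDegree = Q.natDegree := by
    rw [hf.natDegree_mul hg, hs, hQ.2]
  have dr : (f * g - Q).natDegree < Q.natDegree := by
    rw [← lt_deg_iff hQ.1.1 hQ.1.2.1]
    have hd' : (f * g).degree = Q.degree := by
      rw [degree_eq_natDegree hQ.1.1.ne_zero, degree_eq_natDegree hfg.ne_zero, hd]
    rw [← hd']
    exact degree_sub_lt_left hd' hfg.ne_zero (by rw [hQ.1.1.leadingCoeff, hfg.leadingCoeff])
  have := core hν hQ.1 hf.ne_zero hg.ne_zero one_ne_zero (by rw [hQ.2]; exact df)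
    (by rw [hQ.2]; exact dg) dr (by ring)
  rw [hν.1 _ _ hf.ne_zero hg.ne_zero, v_one hν] at this
  linarith

include hν hFm hF hmin

/-- The degree of `F` is a multiple of `α`. -/
lemma deg_dvd (hne : (Psi ν α).Nonempty) : F.natDegree % α = 0 := by
  by_contra hs
  obtain ⟨Q1, hQ1⟩ := hne
  have hα : 0 < α := hQ1.2 ▸ hQ1.1.2.1
  set n := F.natDegree / α with hn
  set s := F.natDegree % α with hsdef
  have hdeg : F.natDegree = n * α + s := by
    rw [hn, hsdef, mul_comm]; exact (Nat.div_add_mod _ _).symm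
  have hsα : s < α := Nat.mod_lt _ hα
  have hspos : 0 < s := Nat.pos_of_ne_zero hs
  -- the main construction
  have key : ∀ Q0 ∈ Psi ν α, ∃ q : Polynomial K, q.Monic ∧ q.natDegree + s = α ∧
      ∃ Q ∈ Psi ν α, ν Q0 ≤ ν Q ∧ NG ν Q ((n + 1 : ℕ) * ν Q0) (q * F) := by
    intro Q0 hQ0
    have hAm : (Q0 ^ (n + 1)).Monic := hQ0.1.1.pow _
    have hAd : (Q0 ^ (n + 1)).natDegree = (n + 1) * α := by
      rw [hQ0.1.1.natDegree_pow, hQ0.2]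
    have hexp : (n + 1) * α = n * α + α := by ring
    set A := Q0 ^ (n + 1) with hA
    have hFpos : 0 < F.natDegree := by omega
    have hqm : (A /ₘ F).Monic := by
      rw [Monic, leadingCoeff_divByMonic_of_monic hFm]
      · exact hAm
      · rw [degree_eq_natDegree hFm.ne_zero, degree_eq_natDegree hAm.ne_zero]
        exact_mod_cast (by omega)
    have hqd : (A /ₘ F).natDegree + s = α := by
      rw [natDegree_divByMonic _ hFm]; omega
    refine ⟨A /ₘ F, hqm, hqd, ?_⟩
    obtain ⟨Q, hQ, hle, hT⟩ := small_T hν hmin hQ0 (mod_deg hFm hFpos A)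
    refine ⟨Q, hQ, hle, ?_⟩
    have hvA : ν A = (n + 1 : ℕ) * ν Q0 := v_pow hν hQ0.1.1.ne_zero _
    rw [← hvA]
    refine compare hν hQ.1 ?_ hT ?_ ?_
    · rw [hvA]
      exact ng_pow hν hQ.1 (ng_other hν hQ hQ0 hle le_rfl) _
    · have := modByMonic_add_div A F
      linear_combination this
    · intro hcon
      rw [hν.1 _ _ hqm.ne_zero hFm.ne_zero] at hcon
      have := ng_cancel hν hQ.1 (by rw [hQ.2]; omega) hqm.ne_zero hcon
      rw [add_sub_cancel_left] at this
      exact F_not hν hF hQ this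
  -- boundedness
  have hbdd : BddAbove (ν '' Psi ν α) := by
    refine ⟨(ν Q1 - s * ν X + ν F) / (n + 1 : ℕ), ?_⟩
    rintro _ ⟨Q0, hQ0, rfl⟩
    obtain ⟨q, hqm, hqd, Q, hQ, hle, hng⟩ := key Q0 hQ0
    have h1 := ng_vge hQ.1.1 hQ.1.2.1 hν hng (mul_ne_zero hqm.ne_zero hFm.ne_zero)
    rw [hν.1 _ _ hqm.ne_zero hFm.ne_zero] at h1
    have h2 := prod_lt hν hQ1 hqm (monic_X_pow s) (by omega) (by rw [natDegree_X_pow]; omega)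
      (by rw [natDegree_X_pow]; omega)
    rw [v_pow hν X_ne_zero] at h2
    rw [le_div_iff₀ (by exact_mod_cast Nat.succ_pos n)]
    linarith
  have key2 : ∀ Q0 ∈ Psi ν α, ∀ Q00 ∈ Psi ν α, ∃ Q ∈ Psi ν α,
      ((n : ℝ) + 1) * ν Q0 < ν Q00 + n * ν Q := by
    intro Q0 hQ0 Q00 hQ00
    obtain ⟨q, hqm, hqd, Q, hQ, hle, hng⟩ := key Q0 hQ0
    refine ⟨Q, hQ, ?_⟩
    have h1 := ng_cancel hν hQ.1 (by rw [hQ.2]; omega) hqm.ne_zero hng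
    obtain ⟨hfm, hfd⟩ := qc_monic hQ.1.1 hQ.1.2.1 (n := n) hFm (by rw [hQ.2]; omega)
      (by rw [hQ.2, add_mul, one_mul]; omega)
    rw [hQ.2] at hfd
    have h2 := h1 n hfm.ne_zero
    have h3 := prod_lt hν hQ00 hqm hfm (by omega) (by omega) (by omega)
    push_cast at h2
    linarith
  set γ := sSup (ν '' Psi ν α) with hγ
  have hle : ∀ Q ∈ Psi ν α, ν Q ≤ γ := fun Q hQ => le_csSup hbdd ⟨Q, hQ, rfl⟩
  have hnn : (0 : ℝ) ≤ n := Nat.cast_nonneg n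
  have hge : ∀ Q ∈ Psi ν α, γ ≤ ν Q := by
    intro Q00 hQ00
    have h1 : γ ≤ (ν Q00 + n * γ) / (n + 1) := by
      refine csSup_le ⟨_, Q1, hQ1, rfl⟩ ?_
      rintro _ ⟨Q0, hQ0, rfl⟩
      obtain ⟨Q, hQ, hlt⟩ := key2 Q0 hQ0 Q00 hQ00
      have := mul_le_mul_of_nonneg_left (hle Q hQ) hnn
      rw [le_div_iff₀ (by linarith)]
      linarith
    rw [le_div_iff₀ (by linarith)] at h1
    linarith
  obtain ⟨Q, hQ, hlt⟩ := key2 Q1 hQ1 Q1 hQ1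
  have e1 := le_antisymm (hle Q hQ) (hge Q hQ)
  have e2 := le_antisymm (hle Q1 hQ1) (hge Q1 hQ1)
  rw [e1, e2] at hlt
  linarith

lemma F_ng {Q0 : Polynomial K} (hQ0 : Q0 ∈ Psi ν α) {n : ℕ}
    (hn : F.natDegree = (n + 1) * α) : NG ν Q0 ((n + 1 : ℕ) * ν Q0) F := by
  have hα : 0 < α := hQ0.2 ▸ hQ0.1.2.1
  have hFpos : 0 < F.natDegree := by rw [hn]; positivity
  have hdlt : ∀ Q ∈ Psi ν α, (Q ^ (n + 1) - F).natDegree < F.natDegree := by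
    intro Q hQ
    have hAm : (Q ^ (n + 1)).Monic := hQ.1.1.pow _
    have hAd : (Q ^ (n + 1)).natDegree = (n + 1) * α := by
      rw [hQ.1.1.natDegree_pow, hQ.2]
    have hd' : (Q ^ (n + 1)).degree = F.degree := by
      rw [degree_eq_natDegree hFm.ne_zero, degree_eq_natDegree hAm.ne_zero, hn, hAd]
    rw [← lt_deg_iff hFm hFpos, ← hd']
    exact degree_sub_lt_left hd' hAm.ne_zero (by rw [hFm.leadingCoeff, hAm.leadingCoeff])
  have key : ∀ Q1 ∈ Psi ν α, ∃ Q ∈ Psi ν α, ν Q1 ≤ ν Q ∧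
      NG ν Q ((n + 1 : ℕ) * ν Q1) F := by
    intro Q1 hQ1
    obtain ⟨Q, hQ, hle, hT⟩ := small_T hν hmin hQ1 (hdlt Q1 hQ1)
    refine ⟨Q, hQ, hle, ?_⟩
    have hvA : ν (Q1 ^ (n + 1)) = (n + 1 : ℕ) * ν Q1 := v_pow hν hQ1.1.1.ne_zero _
    rw [← hvA]
    refine compare hν hQ.1 ?_ hT (by ring) (F_not hν hF hQ)
    rw [hvA]
    exact ng_pow hν hQ.1 (ng_other hν hQ hQ1 hle le_rfl) _
  have hn1 : (0 : ℝ) < (n + 1 : ℕ) := by exact_mod_cast Nat.succ_pos n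
  have hbdd : BddAbove (ν '' Psi ν α) := by
    refine ⟨ν F / (n + 1 : ℕ), ?_⟩
    rintro _ ⟨Q1, hQ1, rfl⟩
    obtain ⟨Q, hQ, hle, hng⟩ := key Q1 hQ1
    have h1 := ng_vge hQ.1.1 hQ.1.2.1 hν hng hFm.ne_zero
    rw [le_div_iff₀ hn1]
    linarith
  set γ := sSup (ν '' Psi ν α) with hγ
  have hle : ∀ Q ∈ Psi ν α, ν Q ≤ γ := fun Q hQ => le_csSup hbdd ⟨Q, hQ, rfl⟩
  have hnn : (0 : ℝ) ≤ n := Nat.cast_nonneg n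
  -- the difference `Q0 ^ (n+1) - F`
  have hstep : ∀ η : ℝ, 0 < η → NG ν Q0 ((n + 1 : ℕ) * ν Q0 - (n + 1 : ℕ) * η) F := by
    intro η hη
    obtain ⟨Q1, hQ1, h0, h1⟩ : ∃ Q1 ∈ Psi ν α, ν Q0 ≤ ν Q1 ∧ γ - η ≤ ν Q1 := by
      obtain ⟨_, ⟨Q1, hQ1, rfl⟩, hlt⟩ := exists_lt_of_lt_csSup
        (s := ν '' Psi ν α) ⟨_, Q0, hQ0, rfl⟩ (show γ - η < γ by linarith)
      rcases le_total (ν Q0) (ν Q1) with hc | hc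
      · exact ⟨Q1, hQ1, hc, hlt.le⟩
      · exact ⟨Q0, hQ0, le_rfl, hlt.le.trans hc⟩
    obtain ⟨Q, hQ, hQQ, hng⟩ := key Q1 hQ1
    have hA : NG ν Q ((n + 1 : ℕ) * ν Q1) (Q ^ (n + 1)) :=
      ng_mono (mul_le_mul_of_nonneg_left hQQ hn1.le)
        (ng_pow hν hQ.1 (ng_other hν hQ hQ le_rfl le_rfl) _)
    have hR := ng_sub hQ.1.1 hQ.1.2.1 hν hA hng
    have hR0 := ng_down hν hQ0 hQ (h0.trans hQQ) (by rw [← hn]; exact hdlt Q hQ) hR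
    have hA0 := ng_pow hν hQ0.1 (ng_other hν hQ0 hQ le_rfl (h0.trans hQQ)) (n + 1)
    have e : F = Q ^ (n + 1) - (Q ^ (n + 1) - F) := by ring
    rw [e]
    refine ng_sub hQ0.1.1 hQ0.1.2.1 hν (ng_mono ?_ hA0) (ng_mono ?_ hR0)
    · have := mul_pos hn1 hη
      linarith
    · have a1 := mul_le_mul_of_nonneg_left (hle Q hQ) hnn
      have a2 := mul_le_mul_of_nonneg_left h1 hn1.le
      have a3 := hle Q0 hQ0
      push_cast at *
      nlinarith
  refine ng_of_le hν hQ0.1.1 hQ0.1.2.1 ?_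
  refine le_of_forall_pos_le_add fun δ hδ => ?_
  have := le_nuQ hν hQ0.1.1 hQ0.1.2.1 hFm.ne_zero (hstep (δ / (n + 1 : ℕ)) (by positivity))
  rw [mul_div_cancel₀ _ hn1.ne'] at this
  linarith

end main

end SuccExp

/-- For a successor key polynomial `F` of `Ψ_α` and every `Q ∈ Ψ_α`:
`δ_Q(F) = deg_Q(F)`, the leading coefficient of the `Q`-expansion of `F` is `1`,
and `ν_Q(F) = deg_Q(F) ⬝ ν(Q)`. -/
theorem successor_expansion (ν : Polynomial K → ℝ) (hν : IsVal ν) (α : ℕ)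
    (hne : (Psi ν α).Nonempty)
    (F : Polynomial K) (hFm : F.Monic) (hF : F ∈ Slim ν α)
    (hmin : ∀ g ∈ Slim ν α, F.natDegree ≤ g.natDegree) :
    ∀ Q ∈ Psi ν α, deltaQ ν Q F = degQ Q F ∧ qc Q F (degQ Q F) = 1 ∧
      nuQ ν Q F = (degQ Q F : ℝ) * ν Q := by
  intro Q hQ
  have hα : 0 < α := hQ.2 ▸ hQ.1.2.1
  have hmod := SuccExp.deg_dvd hν hFm hF hmin hne
  have hge := SuccExp.F_deg hν hF hQ
  have hdeg : F.natDegree = (F.natDegree / α) * α := by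
    have := Nat.div_add_mod F.natDegree α
    rw [hmod, add_zero] at this
    rw [mul_comm]; exact this.symm
  have hn0 : 0 < F.natDegree / α := Nat.div_pos hge hα
  obtain ⟨m, hm⟩ : ∃ m, F.natDegree / α = m + 1 := ⟨F.natDegree / α - 1, by omega⟩
  rw [hm] at hdeg
  have hdq : degQ Q F = m + 1 := by rw [degQ, hQ.2, hm]
  rw [hdq]
  have hng := SuccExp.F_ng hν hFm hF hmin hQ hdeg
  obtain ⟨h1, h2⟩ := SuccExp.qc_monic hQ.1.1 hQ.1.2.1 (n := m + 1) hFm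
    (by rw [hQ.2, hdeg]) (by rw [hQ.2, hdeg]; nlinarith)
  have hone : qc Q F (m + 1) = 1 := by
    refine h1.natDegree_eq_zero.1 ?_
    rw [hQ.2, hdeg] at h2
    omega
  have hle := SuccExp.le_nuQ hν hQ.1.1 hQ.1.2.1 hFm.ne_zero hng
  have hval : ν (qc Q F (m + 1) * Q ^ (m + 1)) = (m + 1 : ℕ) * ν Q := by
    rw [hone, one_mul, SuccExp.v_pow hν hQ.1.1.ne_zero]
  have hne1 : qc Q F (m + 1) ≠ 0 := by rw [hone]; exact one_ne_zero
  have hle2 := SuccExp.nuQ_le hν hQ.1.1 hQ.1.2.1 hne1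
  rw [hval] at hle2
  have hnu := le_antisymm hle2 hle
  refine ⟨?_, hone, hnu⟩
  have hg : IsGreatest (SQ ν Q F) (m + 1) := by
    refine ⟨⟨hne1, by rw [hval, hnu]⟩, ?_⟩
    rintro i ⟨hi, _⟩
    by_contra hlt
    push Not at hlt
    refine hi (SuccExp.qc_eq_zero hQ.1.1 hQ.1.2.1 ?_)
    rw [hQ.2, hdeg]
    exact Nat.mul_lt_mul_of_pos_right hlt hα
  exact hg.csSup_eq
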